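/- The Selberg integral for n = 2: for real α, β, γ with α > 0, β > 0 and γ > -min(1/2, α, β), ∫₀¹∫₀¹ t₁^(α-1) t₂^(α-1) (1-t₁)^(β-1) (1-t₂)^(β-1) |t₁ - t₂|^(2γ) dt₁ dt₂ = ∏_{j=0}^{1} [Γ(α+jγ)Γ(β+jγ)Γ(1+(j+1)γ)] / [Γ(α+β+(1+j)γ)Γ(1+γ)]. -/

import Mathlib

open Real MeasureTheory Finset
section
open Filter Topology
open scoped ENNReal

/-- The integrand of the two-dimensional Selberg integral. -/
noncomputable def selbergIntegrand (γ a b x y : ℝ) : ℝ :=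
  x ^ (a - 1) * y ^ (a - 1) * (1 - x) ^ (b - 1) * (1 - y) ^ (b - 1) * |x - y| ^ (2 * γ)

/-- The two-dimensional Selberg integral as a Lebesgue integral. -/
noncomputable def selbergLintegral (γ a b : ℝ) : ℝ≥0∞ :=
  ∫⁻ x in Set.Ioo (0 : ℝ) 1, ∫⁻ y in Set.Ioo (0 : ℝ) 1, ENNReal.ofReal (selbergIntegrand γ a b x y)

/-- The Selberg integrand restricted to the ray of slope `u`, up to a factor depending on `u`. -/
noncomputable def rayIntegrand (c b u x : ℝ) : ℝ :=
  x ^ (c - 1) * ((1 - x) * (1 - x * u)) ^ (b - 1)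

/-- The integral of `rayIntegrand` over the unit interval. -/
noncomputable def rayLintegral (c b u : ℝ) : ℝ≥0∞ :=
  ∫⁻ x in Set.Ioo (0 : ℝ) 1, ENNReal.ofReal (rayIntegrand c b u x)

theorem lintegral_rpow_mul_one_sub_rpow {a b : ℝ} (ha : 0 < a) (hb : 0 < b) :
    ∫⁻ x in Set.Ioo (0 : ℝ) 1, ENNReal.ofReal (x ^ (a - 1) * (1 - x) ^ (b - 1)) =
      ENNReal.ofReal (ProbabilityTheory.beta a b) := by
  have hB := ProbabilityTheory.beta_pos ha hb
  have h := ProbabilityTheory.lintegral_betaPDF_eq_one ha hb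
  rw [ProbabilityTheory.lintegral_betaPDF] at h
  simp_rw [mul_assoc, ENNReal.ofReal_mul (one_div_pos.2 hB).le] at h
  rw [lintegral_const_mul _ (by fun_prop)] at h
  calc _ = ENNReal.ofReal (ProbabilityTheory.beta a b) *
        (ENNReal.ofReal (1 / ProbabilityTheory.beta a b) *
          ∫⁻ x in Set.Ioo (0 : ℝ) 1, ENNReal.ofReal (x ^ (a - 1) * (1 - x) ^ (b - 1))) := by
        rw [← mul_assoc, ← ENNReal.ofReal_mul hB.le, mul_one_div_cancel hB.ne']
        simp
    _ = _ := by rw [h, mul_one]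

theorem integrableOn_rpow_mul_one_sub_rpow {a b : ℝ} (ha : 0 < a) (hb : 0 < b) :
    IntegrableOn (fun x : ℝ => x ^ (a - 1) * (1 - x) ^ (b - 1)) (Set.Ioo 0 1) := by
  refine (lintegral_ofReal_ne_top_iff_integrable (by fun_prop) ?_).1 ?_
  · refine (ae_restrict_iff' measurableSet_Ioo).2 (ae_of_all _ fun x hx => ?_)
    exact mul_nonneg (rpow_nonneg hx.1.le _) (rpow_nonneg (by linarith [hx.2]) _)
  · rw [lintegral_rpow_mul_one_sub_rpow ha hb]
    exact ENNReal.ofReal_ne_top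

theorem rayIntegrand_nonneg {c b u x : ℝ} (hu : u ∈ Set.Ioo (0 : ℝ) 1)
    (hx : x ∈ Set.Ioo (0 : ℝ) 1) : 0 ≤ rayIntegrand c b u x := by
  obtain ⟨h0, h1⟩ := hx
  have : 0 < 1 - x * u := by nlinarith [hu.1, hu.2]
  exact mul_nonneg (rpow_nonneg h0.le _) (rpow_nonneg (mul_nonneg (by linarith) this.le) _)

theorem integrableOn_rayIntegrand {c b u : ℝ} (hc : 0 < c) (hb : 0 < b)
    (hu : u ∈ Set.Ioo (0 : ℝ) 1) : IntegrableOn (rayIntegrand c b u) (Set.Ioo 0 1) := by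
  have h := integrableOn_rpow_mul_one_sub_rpow hc hb
  rw [← integrableOn_Icc_iff_integrableOn_Ioo] at h
  have hpos : ∀ x ∈ Set.Icc (0 : ℝ) 1, 0 < 1 - x * u := fun x hx => by
    nlinarith [hu.1, hu.2, hx.1, hx.2]
  have h2 : ContinuousOn (fun x : ℝ => (1 - x * u) ^ (b - 1)) (Set.Icc 0 1) :=
    ContinuousOn.rpow_const (by fun_prop) fun x hx => Or.inl (hpos x hx).ne'
  have h3 := h.mul_continuousOn h2 isCompact_Icc
  rw [integrableOn_Icc_iff_integrableOn_Ioo] at h3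
  refine h3.congr_fun (fun x hx => ?_) measurableSet_Ioo
  simp only [rayIntegrand]
  rw [mul_rpow (by linarith [hx.2]) (hpos x ⟨hx.1.le, hx.2.le⟩).le, mul_assoc]

theorem integral_rayIntegrand_recurrence {c b u : ℝ} (hc : 0 < c) (hb : 0 < b)
    (hu : u ∈ Set.Ioo (0 : ℝ) 1) :
    (c + b) * (∫ x in Set.Ioo (0 : ℝ) 1, rayIntegrand c (b + 1) u x) +
        b * u * (∫ x in Set.Ioo (0 : ℝ) 1, rayIntegrand (c + 2) b u x) =
      b * ∫ x in Set.Ioo (0 : ℝ) 1, rayIntegrand c b u x := by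
  have i1 := (integrableOn_rayIntegrand hc (by linarith : 0 < b + 1) hu).const_mul (c + b)
  have i2 := (integrableOn_rayIntegrand (by linarith : 0 < c + 2) hb hu).const_mul (b * u)
  have i3 := (integrableOn_rayIntegrand hc hb hu).const_mul b
  have i12 : IntegrableOn (fun x => (c + b) * rayIntegrand c (b + 1) u x +
      b * u * rayIntegrand (c + 2) b u x) (Set.Ioo 0 1) := i1.add i2
  have key := intervalIntegral.integral_eq_sub_of_hasDerivAt_of_le (zero_le_one' ℝ)
    (f := fun x : ℝ => x ^ c * ((1 - x) * (1 - x * u)) ^ b)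
    (f' := fun x => (c + b) * rayIntegrand c (b + 1) u x + b * u * rayIntegrand (c + 2) b u x -
      b * rayIntegrand c b u x)
    (ContinuousOn.mul (ContinuousOn.rpow_const (by fun_prop) fun _ _ => Or.inr hc.le)
      (ContinuousOn.rpow_const (by fun_prop) fun _ _ => Or.inr hb.le)) ?_ ?_
  · rw [intervalIntegral.integral_of_le zero_le_one, integral_Ioc_eq_integral_Ioo,
      integral_sub i12 i3, integral_add i1 i2] at key
    simp only [integral_const_mul] at key
    simp [hb.ne', hc.ne'] at key
    linarith
  · intro x hx
    have hD1 : 0 < 1 - x := by linarith [hx.2]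
    have hD2 : 0 < 1 - x * u := by nlinarith [hu.1, hu.2, hx.1, hx.2]
    have hD := mul_pos hD1 hD2
    have d1 : HasDerivAt (fun x : ℝ => (1 - x) * (1 - x * u))
        ((-1) * (1 - x * u) + (1 - x) * (-(1 * u))) x :=
      ((hasDerivAt_id x).const_sub 1).mul (((hasDerivAt_id x).mul_const u).const_sub 1)
    have d2 := (hasDerivAt_rpow_const (p := c) (Or.inl hx.1.ne')).mul
      (d1.rpow_const (p := b) (Or.inl hD.ne'))
    refine d2.congr_deriv ?_
    simp only [rayIntegrand]
    have e1 : x ^ c = x ^ (c - 1) * x := by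
      rw [← rpow_add_one hx.1.ne']; ring_nf
    have e2 : x ^ (c + 2 - 1) = x ^ (c - 1) * x ^ 2 := by
      rw [← rpow_natCast, ← rpow_add hx.1]; push_cast; ring_nf
    have e3 : ((1 - x) * (1 - x * u)) ^ b =
        ((1 - x) * (1 - x * u)) ^ (b - 1) * ((1 - x) * (1 - x * u)) := by
      rw [← rpow_add_one hD.ne']; ring_nf
    rw [e1, e2, add_sub_cancel_right, e3]
    ring
  · rw [intervalIntegrable_iff_integrableOn_Ioo_of_le zero_le_one]
    exact i12.sub i3

theorem rayLintegral_eq_ofReal {c b u : ℝ} (hc : 0 < c) (hb : 0 < b)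
    (hu : u ∈ Set.Ioo (0 : ℝ) 1) :
    rayLintegral c b u = ENNReal.ofReal (∫ x in Set.Ioo (0 : ℝ) 1, rayIntegrand c b u x) :=
  (ofReal_integral_eq_lintegral_ofReal (integrableOn_rayIntegrand hc hb hu)
    ((ae_restrict_iff' measurableSet_Ioo).2
      (ae_of_all _ fun _ hx => rayIntegrand_nonneg hu hx))).symm

theorem rayLintegral_recurrence {c b u : ℝ} (hc : 0 < c) (hb : 0 < b)
    (hu : u ∈ Set.Ioo (0 : ℝ) 1) :
    ENNReal.ofReal (c + b) * rayLintegral c (b + 1) u +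
        ENNReal.ofReal b * (ENNReal.ofReal u * rayLintegral (c + 2) b u) =
      ENNReal.ofReal b * rayLintegral c b u := by
  have hn : ∀ c b, 0 ≤ ∫ x in Set.Ioo (0 : ℝ) 1, rayIntegrand c b u x := fun c b =>
    setIntegral_nonneg measurableSet_Ioo fun x hx => rayIntegrand_nonneg hu hx
  have hcb : 0 < c + b := by linarith
  rw [rayLintegral_eq_ofReal hc hb hu, rayLintegral_eq_ofReal hc (by linarith) hu,
    rayLintegral_eq_ofReal (by linarith) hb hu, ← ENNReal.ofReal_mul hb.le,
    ← integral_rayIntegrand_recurrence hc hb hu, ← ENNReal.ofReal_mul hu.1.le,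
    ← ENNReal.ofReal_mul hb.le, ← ENNReal.ofReal_mul hcb.le,
    ← ENNReal.ofReal_add (mul_nonneg hcb.le (hn _ _))
      (mul_nonneg hb.le (mul_nonneg hu.1.le (hn _ _))), mul_assoc b u]

@[fun_prop]
theorem measurable_uncurry_rayIntegrand (c b : ℝ) :
    Measurable (fun p : ℝ × ℝ => rayIntegrand c b p.1 p.2) := by
  unfold rayIntegrand
  fun_prop

@[fun_prop]
theorem measurable_uncurry_selbergIntegrand (γ a b : ℝ) :
    Measurable (fun p : ℝ × ℝ => selbergIntegrand γ a b p.1 p.2) := by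
  unfold selbergIntegrand
  fun_prop

theorem measurable_rayLintegral (c b : ℝ) : Measurable (rayLintegral c b) :=
  Measurable.lintegral_prod_right' (f := fun p : ℝ × ℝ => ENNReal.ofReal (rayIntegrand c b p.1 p.2))
    (by fun_prop)

/-- The integral of a symmetric function over the unit square is twice the integral over the
triangle below the diagonal. -/
theorem lintegral_unitSquare_eq_two_mul {f : ℝ → ℝ → ℝ≥0∞} (hf : Measurable (Function.uncurry f))
    (hsymm : ∀ x y, f x y = f y x) :
    ∫⁻ x in Set.Ioo (0 : ℝ) 1, ∫⁻ y in Set.Ioo (0 : ℝ) 1, f x y =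
      2 * ∫⁻ x in Set.Ioo (0 : ℝ) 1, ∫⁻ y in Set.Ioo (0 : ℝ) x, f x y := by
  have hlt : MeasurableSet {p : ℝ × ℝ | p.2 < p.1} := measurableSet_lt measurable_snd measurable_fst
  set g : ℝ → ℝ → ℝ≥0∞ := fun x y => (Set.Iio x).indicator (f x) y with hg
  have hgm : Measurable (Function.uncurry g) := by
    have : Function.uncurry g = {p : ℝ × ℝ | p.2 < p.1}.indicator (Function.uncurry f) := by
      ext p
      simp [g, Function.uncurry, Set.indicator]
    rw [this]
    exact hf.indicator hlt
  have hgx : ∀ x, Measurable (g x) := fun x => hgm.comp measurable_prodMk_left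
  have hsplit : ∀ x : ℝ, ∫⁻ y in Set.Ioo (0 : ℝ) 1, f x y =
      (∫⁻ y in Set.Ioo (0 : ℝ) 1, g x y) + ∫⁻ y in Set.Ioo (0 : ℝ) 1, g y x := fun x => by
    rw [← lintegral_add_left (hgx x)]
    refine lintegral_congr_ae (ae_restrict_of_ae ?_)
    filter_upwards [compl_mem_ae_iff.2 (measure_singleton (μ := volume) x)] with y hy
    rcases lt_or_gt_of_ne (show y ≠ x from hy) with h | h
    · simp [g, Set.indicator, h, h.not_gt]
    · simp [g, Set.indicator, h, h.not_gt, hsymm x y]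
  have htri : ∀ x ∈ Set.Ioo (0 : ℝ) 1,
      ∫⁻ y in Set.Ioo (0 : ℝ) 1, g x y = ∫⁻ y in Set.Ioo (0 : ℝ) x, f x y := fun x hx => by
    rw [hg, lintegral_indicator measurableSet_Iio, Measure.restrict_restrict measurableSet_Iio]
    congr 2
    ext y
    simp only [Set.mem_inter_iff, Set.mem_Iio, Set.mem_Ioo]
    constructor
    · rintro ⟨h1, h2, h3⟩; exact ⟨h2, h1⟩
    · rintro ⟨h1, h2⟩; exact ⟨h2, h1, h2.trans hx.2⟩
  simp_rw [hsplit]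
  rw [lintegral_add_left (Measurable.lintegral_prod_right hgm),
    lintegral_lintegral_swap (f := fun x y => g y x) (hgm.comp measurable_swap).aemeasurable,
    ← two_mul, setLIntegral_congr_fun measurableSet_Ioo htri]

theorem lintegral_Ioo_zero_eq_mul {x : ℝ} (hx : 0 < x) (f : ℝ → ℝ≥0∞) :
    ∫⁻ y in Set.Ioo (0 : ℝ) x, f y =
      ∫⁻ u in Set.Ioo (0 : ℝ) 1, ENNReal.ofReal x * f (x * u) := by
  have h := lintegral_image_eq_lintegral_abs_deriv_mul (s := Set.Ioo (0 : ℝ) 1)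
    (f := fun u => x * u) (f' := fun _ => x) measurableSet_Ioo
    (fun u _ => by simpa using ((hasDerivAt_id u).const_mul x).hasDerivWithinAt)
    (fun u _ v _ h => mul_left_cancel₀ hx.ne' h) f
  rw [Set.image_mul_left_Ioo hx] at h
  simpa [abs_of_pos hx] using h

theorem selbergIntegrand_comm (γ a b x y : ℝ) :
    selbergIntegrand γ a b x y = selbergIntegrand γ a b y x := by
  unfold selbergIntegrand
  rw [abs_sub_comm]
  ring

theorem mul_selbergIntegrand_mul {γ a b x u : ℝ} (hx : x ∈ Set.Ioo (0 : ℝ) 1)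
    (hu : u ∈ Set.Ioo (0 : ℝ) 1) :
    x * selbergIntegrand γ a b x (x * u) =
      u ^ (a - 1) * (1 - u) ^ (2 * γ) * rayIntegrand (2 * a + 2 * γ) b u x := by
  have h1 : 0 < 1 - x := by linarith [hx.2]
  have h2 : 0 < 1 - u := by linarith [hu.2]
  have h3 : 0 < 1 - x * u := by nlinarith [hu.1, hu.2, hx.1, hx.2]
  have e1 : |x - x * u| = x * (1 - u) := by
    rw [abs_of_pos] <;> nlinarith [mul_pos hx.1 h2]
  have e2 : x ^ (2 * a + 2 * γ - 1) = x * (x ^ (a - 1) * x ^ (a - 1) * x ^ (2 * γ)) := by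
    rw [← rpow_add hx.1, ← rpow_add hx.1, mul_comm x, ← rpow_add_one hx.1.ne']
    ring_nf
  unfold selbergIntegrand rayIntegrand
  rw [e1, mul_rpow hx.1.le hu.1.le, mul_rpow hx.1.le h2.le, mul_rpow h1.le h3.le, e2]
  ring

theorem selbergLintegral_eq (γ a b : ℝ) :
    selbergLintegral γ a b = 2 * ∫⁻ u in Set.Ioo (0 : ℝ) 1,
      ENNReal.ofReal (u ^ (a - 1) * (1 - u) ^ (2 * γ)) * rayLintegral (2 * a + 2 * γ) b u := by
  unfold selbergLintegral
  rw [lintegral_unitSquare_eq_two_mul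
    (f := fun x y => ENNReal.ofReal (selbergIntegrand γ a b x y))
    (measurable_uncurry_selbergIntegrand γ a b).ennreal_ofReal
    fun x y => by rw [selbergIntegrand_comm]]
  congr 1
  rw [setLIntegral_congr_fun measurableSet_Ioo fun x hx => lintegral_Ioo_zero_eq_mul hx.1 _,
    lintegral_lintegral_swap]
  · refine setLIntegral_congr_fun measurableSet_Ioo fun u hu => ?_
    simp only [rayLintegral]
    rw [← lintegral_const_mul _ ?_]
    · refine setLIntegral_congr_fun measurableSet_Ioo fun x hx => ?_
      rw [← ENNReal.ofReal_mul hx.1.le, mul_selbergIntegrand_mul hx hu, ENNReal.ofReal_mul]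
      exact mul_nonneg (rpow_nonneg hu.1.le _) (rpow_nonneg (by linarith [hu.2]) _)
    · exact ((measurable_uncurry_rayIntegrand _ _).comp measurable_prodMk_left).ennreal_ofReal
  · refine Measurable.aemeasurable ?_
    have : Measurable fun p : ℝ × ℝ => selbergIntegrand γ a b p.1 (p.1 * p.2) :=
      (measurable_uncurry_selbergIntegrand γ a b).comp
        (by fun_prop : Measurable fun p : ℝ × ℝ => (p.1, p.1 * p.2))
    exact (measurable_fst.ennreal_ofReal).mul this.ennreal_ofReal

theorem selbergLintegral_comm (γ a b : ℝ) : selbergLintegral γ a b = selbergLintegral γ b a := by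
  have hrefl : ∀ f : ℝ → ℝ≥0∞, ∫⁻ x in Set.Ioo (0 : ℝ) 1, f x =
      ∫⁻ x in Set.Ioo (0 : ℝ) 1, f (1 - x) := fun f => by
    have h := lintegral_image_eq_lintegral_abs_deriv_mul (s := Set.Ioo (0 : ℝ) 1)
      (f := fun u => 1 - u) (f' := fun _ => -1) measurableSet_Ioo
      (fun u _ => ((hasDerivAt_id u).const_sub 1).hasDerivWithinAt)
      (fun u _ v _ h => sub_right_injective h) f
    simpa using h
  unfold selbergLintegral
  rw [hrefl]
  refine setLIntegral_congr_fun measurableSet_Ioo fun x _ => ?_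
  rw [hrefl]
  refine setLIntegral_congr_fun measurableSet_Ioo fun y _ => ?_
  unfold selbergIntegrand
  simp only [sub_sub_cancel]
  rw [sub_sub_sub_cancel_left, abs_sub_comm y x]
  ring_nf

theorem selbergIntegrand_nonneg {γ a b x y : ℝ} (hx : x ∈ Set.Ioo (0 : ℝ) 1)
    (hy : y ∈ Set.Ioo (0 : ℝ) 1) : 0 ≤ selbergIntegrand γ a b x y := by
  have h1 : 0 < 1 - x := by linarith [hx.2]
  have h2 : 0 < 1 - y := by linarith [hy.2]
  have := hx.1
  have := hy.1
  unfold selbergIntegrand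
  positivity

theorem selbergLintegral_anti (γ b : ℝ) : Antitone fun a => selbergLintegral γ a b := by
  intro a a' h
  refine setLIntegral_mono' measurableSet_Ioo fun x hx =>
    setLIntegral_mono' measurableSet_Ioo fun y hy => ENNReal.ofReal_le_ofReal ?_
  have h1 : 0 < 1 - x := by linarith [hx.2]
  have h2 : 0 < 1 - y := by linarith [hy.2]
  have hx0 := hx.1
  have hy0 := hy.1
  have e1 := rpow_le_rpow_of_exponent_ge hx.1 hx.2.le (sub_le_sub_right h 1)
  have e2 := rpow_le_rpow_of_exponent_ge hy.1 hy.2.le (sub_le_sub_right h 1)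
  unfold selbergIntegrand
  gcongr

theorem selbergLintegral_recurrence {γ a b : ℝ} (ha : 0 < a + γ) (hb : 0 < b) :
    ENNReal.ofReal (2 * a + 2 * γ + b) * selbergLintegral γ a (b + 1) +
        ENNReal.ofReal b * selbergLintegral γ (a + 1) b =
      ENNReal.ofReal b * selbergLintegral γ a b := by
  have hm : ∀ a c b : ℝ, Measurable fun u : ℝ =>
      ENNReal.ofReal (u ^ (a - 1) * (1 - u) ^ (2 * γ)) * rayLintegral c b u := fun a c b =>
    Measurable.mul (by fun_prop) (measurable_rayLintegral c b)
  simp only [selbergLintegral_eq, mul_left_comm _ (2 : ℝ≥0∞)]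
  rw [← mul_add, ← lintegral_const_mul _ (hm _ _ _), ← lintegral_const_mul _ (hm _ _ _),
    ← lintegral_const_mul _ (hm _ _ _), ← lintegral_add_left ((hm _ _ _).const_mul _)]
  congr 1
  refine setLIntegral_congr_fun measurableSet_Ioo fun u hu => ?_
  have e : ENNReal.ofReal (u ^ (a + 1 - 1) * (1 - u) ^ (2 * γ)) =
      ENNReal.ofReal (u ^ (a - 1) * (1 - u) ^ (2 * γ)) * ENNReal.ofReal u := by
    rw [← ENNReal.ofReal_mul' hu.1.le]
    congr 1
    rw [mul_right_comm, ← rpow_add_one hu.1.ne']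
    ring_nf
  simp only [e]
  have := rayLintegral_recurrence (c := 2 * a + 2 * γ) (by linarith) hb hu
  rw [mul_left_comm (ENNReal.ofReal b) _ (rayLintegral (2 * a + 2 * γ) b u), ← this,
    show 2 * (a + 1) + 2 * γ = 2 * a + 2 * γ + 2 by ring]
  ring

theorem rayIntegrand_le {c b u x p q : ℝ} (hp : 0 ≤ p) (hq : 0 ≤ q) (hpq : 1 - b ≤ p + q)
    (hu : u ∈ Set.Ioo (0 : ℝ) 1) (hx : x ∈ Set.Ioo (0 : ℝ) 1) :
    rayIntegrand c b u x ≤ (1 - u) ^ (-q) * (x ^ (c - 1) * (1 - x) ^ (b - p - 1)) := by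
  have h1 : 0 < 1 - x := by linarith [hx.2]
  have h2 : 0 < 1 - u := by linarith [hu.2]
  have h3 : 0 < 1 - x * u := by nlinarith [hu.1, hu.2, hx.1, hx.2]
  have h4 : 1 - x * u ≤ 1 := by nlinarith [hu.1, hx.1, mul_pos hx.1 hu.1]
  have h5 : 1 - x ≤ 1 - x * u := by nlinarith [hx.1]
  have h6 : 1 - u ≤ 1 - x * u := by nlinarith [hu.1]
  have hx0 := hx.1
  have key : (1 - x * u) ^ (b - 1) ≤ (1 - x) ^ (-p) * (1 - u) ^ (-q) := calc
    (1 - x * u) ^ (b - 1) ≤ (1 - x * u) ^ (-p + -q) :=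
      rpow_le_rpow_of_exponent_ge h3 h4 (by linarith)
    _ = (1 - x * u) ^ (-p) * (1 - x * u) ^ (-q) := rpow_add h3 _ _
    _ ≤ _ := mul_le_mul (rpow_le_rpow_of_nonpos h1 h5 (by linarith))
      (rpow_le_rpow_of_nonpos h2 h6 (by linarith)) (rpow_nonneg h3.le _) (rpow_nonneg h1.le _)
  calc rayIntegrand c b u x = x ^ (c - 1) * ((1 - x) ^ (b - 1) * (1 - x * u) ^ (b - 1)) := by
        rw [rayIntegrand, mul_rpow h1.le h3.le]
    _ ≤ x ^ (c - 1) * ((1 - x) ^ (b - 1) * ((1 - x) ^ (-p) * (1 - u) ^ (-q))) := by gcongr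
    _ = _ := by
        rw [show b - p - 1 = b - 1 + -p by ring, rpow_add h1]
        ring

theorem selbergLintegral_ne_top {γ a b : ℝ} (hγ : 0 < 2 * γ + 1) (ha : 0 < a) (haγ : 0 < a + γ)
    (hb : 0 < b) (hbγ : 0 < b + γ) : selbergLintegral γ a b ≠ ∞ := by
  obtain ⟨p, q, hp, hq, hpq, hpb, hqγ⟩ : ∃ p q : ℝ, 0 ≤ p ∧ 0 ≤ q ∧ 1 - b ≤ p + q ∧
      0 < b - p ∧ 0 < 2 * γ + 1 - q := by
    rcases le_or_gt 1 b with h | h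
    · exact ⟨0, 0, le_rfl, le_rfl, by linarith, by linarith, by linarith⟩
    · have hs : 0 < b + 2 * γ + 1 := by linarith
      set t := (1 - b) / (b + 2 * γ + 1) with ht
      have ht0 : 0 ≤ t := div_nonneg (by linarith) hs.le
      have ht1 : 0 < 1 - t := by rw [sub_pos, ht, div_lt_one hs]; linarith
      refine ⟨t * b, t * (2 * γ + 1), by positivity, by positivity, ?_, ?_, ?_⟩
      · rw [← mul_add, ← add_assoc, ht, div_mul_cancel₀ _ hs.ne']
      · nlinarith [mul_pos ht1 hb]
      · nlinarith [mul_pos ht1 hγ]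
  rw [selbergLintegral_eq]
  refine ENNReal.mul_ne_top (by simp) (ne_top_of_le_ne_top (b := ∫⁻ u in Set.Ioo (0 : ℝ) 1,
    ENNReal.ofReal (u ^ (a - 1) * (1 - u) ^ (2 * γ + 1 - q - 1)) *
      ENNReal.ofReal (ProbabilityTheory.beta (2 * a + 2 * γ) (b - p))) ?_ ?_)
  · rw [lintegral_mul_const _ (by fun_prop), lintegral_rpow_mul_one_sub_rpow ha hqγ]
    exact ENNReal.mul_ne_top ENNReal.ofReal_ne_top ENNReal.ofReal_ne_top
  · refine setLIntegral_mono' measurableSet_Ioo fun u hu => ?_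
    have h2 : 0 < 1 - u := by linarith [hu.2]
    have hray : rayLintegral (2 * a + 2 * γ) b u ≤ ENNReal.ofReal ((1 - u) ^ (-q)) *
        ENNReal.ofReal (ProbabilityTheory.beta (2 * a + 2 * γ) (b - p)) := by
      rw [← lintegral_rpow_mul_one_sub_rpow (by linarith) hpb,
        ← lintegral_const_mul _ (by fun_prop)]
      refine setLIntegral_mono' measurableSet_Ioo fun x hx => ?_
      rw [← ENNReal.ofReal_mul (rpow_nonneg h2.le _)]
      exact ENNReal.ofReal_le_ofReal (rayIntegrand_le hp hq hpq hu hx)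
    refine (mul_le_mul_right hray _).trans_eq ?_
    rw [← mul_assoc, ← ENNReal.ofReal_mul' (rpow_nonneg h2.le _), mul_assoc, ← rpow_add h2]
    ring_nf

theorem selbergLintegral_one_one {γ : ℝ} (hγ : 0 < 2 * γ + 1) :
    (selbergLintegral γ 1 1).toReal = 1 / ((1 + γ) * (1 + 2 * γ)) := by
  have h1 : ∀ u, rayLintegral (2 * 1 + 2 * γ) 1 u =
      ENNReal.ofReal (ProbabilityTheory.beta (2 * γ + 2) 1) := fun u => by
    rw [← lintegral_rpow_mul_one_sub_rpow (by linarith) one_pos]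
    simp [rayLintegral, rayIntegrand, add_comm]
  have h2 := lintegral_rpow_mul_one_sub_rpow one_pos hγ
  have hbeta : ∀ s : ℝ, 0 < s → ProbabilityTheory.beta s 1 = 1 / s := fun s hs => by
    have := (Gamma_pos_of_pos hs).ne'
    rw [ProbabilityTheory.beta, Gamma_add_one hs.ne', Gamma_one]
    field_simp
  have hcomm : ProbabilityTheory.beta 1 (2 * γ + 1) = ProbabilityTheory.beta (2 * γ + 1) 1 := by
    simp only [ProbabilityTheory.beta, add_comm, mul_comm]
  have hγ2 : 0 < 2 * γ + 2 := by linarith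
  rw [selbergLintegral_eq]
  simp_rw [h1]
  rw [lintegral_mul_const _ (by fun_prop)]
  rw [add_sub_cancel_right] at h2
  rw [h2, hcomm, hbeta _ hγ, hbeta _ hγ2]
  have : 1 + γ ≠ 0 := by linarith
  have : 1 + 2 * γ ≠ 0 := by linarith
  have := hγ.ne'
  have := hγ2.ne'
  rw [ENNReal.toReal_mul, ENNReal.toReal_mul, ENNReal.toReal_ofReal (by positivity),
    ENNReal.toReal_ofReal (by positivity)]
  simp only [ENNReal.toReal_ofNat]
  rw [show 2 * γ + 2 = 2 * (1 + γ) by ring, add_comm (2 * γ) 1]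
  field_simp

theorem toReal_selbergLintegral_succ {γ a b : ℝ} (hγ : 0 < 2 * γ + 1) (ha : 0 < a)
    (haγ : 0 < a + γ) (hb : 0 < b) (hbγ : 0 < b + γ) :
    (selbergLintegral γ (a + 1) b).toReal =
      a * (a + γ) / ((a + b + γ) * (a + b + 2 * γ)) * (selbergLintegral γ a b).toReal := by
  have e1 := selbergLintegral_recurrence haγ hb
  have e2 := selbergLintegral_recurrence hbγ ha
  rw [selbergLintegral_comm γ b (a + 1), selbergLintegral_comm γ (b + 1) a,
    selbergLintegral_comm γ b a] at e2
  have f0 := selbergLintegral_ne_top hγ ha haγ hb hbγ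
  have f1 := selbergLintegral_ne_top (a := a + 1) hγ (by linarith) (by linarith) hb hbγ
  have f2 := selbergLintegral_ne_top (b := b + 1) hγ ha haγ (by linarith) (by linarith)
  have r1 := congrArg ENNReal.toReal e1
  have r2 := congrArg ENNReal.toReal e2
  rw [ENNReal.toReal_add (ENNReal.mul_ne_top ENNReal.ofReal_ne_top ‹_›)
    (ENNReal.mul_ne_top ENNReal.ofReal_ne_top ‹_›)] at r1 r2
  simp only [ENNReal.toReal_mul] at r1 r2
  rw [ENNReal.toReal_ofReal hb.le, ENNReal.toReal_ofReal (by linarith)] at r1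
  rw [ENNReal.toReal_ofReal ha.le, ENNReal.toReal_ofReal (by linarith)] at r2
  have p1 : 0 < a + b + γ := by linarith
  have p2 : 0 < a + b + 2 * γ := by linarith
  rw [div_mul_eq_mul_div, eq_div_iff (by positivity)]
  linear_combination (-a / 2) * r1 + ((2 * a + 2 * γ + b) / 2) * r2

theorem beta_anti {a a' b : ℝ} (ha : 0 < a) (haa' : a ≤ a') (hb : 0 < b) :
    ProbabilityTheory.beta a' b ≤ ProbabilityTheory.beta a b := by
  rw [← ENNReal.ofReal_le_ofReal_iff (ProbabilityTheory.beta_pos ha hb).le,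
    ← lintegral_rpow_mul_one_sub_rpow ha hb, ← lintegral_rpow_mul_one_sub_rpow (ha.trans_le haa') hb]
  refine setLIntegral_mono' measurableSet_Ioo fun x hx => ENNReal.ofReal_le_ofReal ?_
  have h1 : 0 < 1 - x := by linarith [hx.2]
  exact mul_le_mul_of_nonneg_right
    (rpow_le_rpow_of_exponent_ge hx.1 hx.2.le (sub_le_sub_right haa' 1)) (rpow_nonneg h1.le _)

theorem beta_add_one_left {a b : ℝ} (ha : 0 < a) (hb : 0 < b) :
    ProbabilityTheory.beta (a + 1) b = a / (a + b) * ProbabilityTheory.beta a b := by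
  have hab : 0 < a + b := by linarith
  have := (Gamma_pos_of_pos hab).ne'
  rw [ProbabilityTheory.beta, ProbabilityTheory.beta, add_right_comm, Gamma_add_one ha.ne',
    Gamma_add_one hab.ne']
  field_simp

theorem tendsto_add_div_add_atTop (p q : ℝ) :
    Tendsto (fun x : ℝ => (x + p) / (x + q)) atTop (𝓝 1) := by
  have h : Tendsto (fun x : ℝ => 1 + (p - q) / (x + q)) atTop (𝓝 (1 + 0)) :=
    tendsto_const_nhds.add
      (tendsto_const_nhds.div_atTop (tendsto_atTop_add_const_right _ _ tendsto_id))
  rw [add_zero] at h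
  refine h.congr' ?_
  filter_upwards [eventually_gt_atTop (-q)] with x hx
  have : x + q ≠ 0 := by linarith
  field_simp
  ring

/-- Two nonnegative antitone solutions of a functional equation `f (x + 1) = ρ x * f x` are
proportional if `ρ` tends to `1`. -/
theorem mul_eq_mul_of_antitoneOn_of_add_one {f g ρ : ℝ → ℝ} {m : ℝ}
    (hf : AntitoneOn f (Set.Ioi m)) (hg : AntitoneOn g (Set.Ioi m)) (hf0 : ∀ x, m < x → 0 ≤ f x)
    (hg0 : ∀ x, m < x → 0 < g x) (hfρ : ∀ x, m < x → f (x + 1) = ρ x * f x)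
    (hgρ : ∀ x, m < x → g (x + 1) = ρ x * g x) (hρ : Tendsto ρ atTop (𝓝 1)) {x y : ℝ}
    (hx : m < x) (hy : m < y) : f x * g y = f y * g x := by
  have hρ0 : ∀ x, m < x → 0 < ρ x := fun x hx => by
    have h := hg0 (x + 1) (by linarith)
    rw [hgρ x hx] at h
    exact pos_of_mul_pos_left h (hg0 x hx).le
  have hper : ∀ x, m < x → ∀ n : ℕ, f (x + n) / g (x + n) = f x / g x := fun x hx n => by
    induction n with
    | zero => simp
    | succ n ih =>
      have hxn : m < x + n := by have := n.cast_nonneg (α := ℝ); linarith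
      rw [Nat.cast_succ, ← add_assoc, hfρ _ hxn, hgρ _ hxn, mul_div_mul_left _ _ (hρ0 _ hxn).ne', ih]
  have hclose : ∀ x y, m < x → x ≤ y → y ≤ x + 1 → f y / g y = f x / g x := by
    intro x y hx hxy hyx
    have hlim : Tendsto (fun n : ℕ => ρ (x + n)) atTop (𝓝 1) :=
      hρ.comp (tendsto_atTop_add_const_left _ _ tendsto_natCast_atTop_atTop)
    have hbound : ∀ n : ℕ, f x / g x * ρ (x + n) ≤ f y / g y ∧
        f y / g y ≤ f x / g x / ρ (x + n) := fun n => by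
      have hn := n.cast_nonneg (α := ℝ)
      have hxn : m < x + n := by linarith
      have hyn : m < y + n := by linarith
      have hxn1 : m < x + n + 1 := by linarith
      have := hρ0 _ hxn
      have := hg0 _ hxn
      rw [← hper y (by linarith) n, ← hper x hx n]
      constructor
      · calc f (x + n) / g (x + n) * ρ (x + n) = f (x + n + 1) / g (x + n) := by
              rw [hfρ _ hxn]; ring
          _ ≤ f (y + n) / g (y + n) := div_le_div₀ (hf0 _ hyn)
              (hf hyn hxn1 (by linarith)) (hg0 _ hyn) (hg hxn hyn (by linarith))
      · calc f (y + n) / g (y + n) ≤ f (x + n) / g (x + n + 1) := div_le_div₀ (hf0 _ hxn)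
              (hf hxn hyn (by linarith)) (hg0 _ hxn1) (hg hyn hxn1 (by linarith))
          _ = f (x + n) / g (x + n) / ρ (x + n) := by
              rw [hgρ _ hxn]; field_simp
    refine le_antisymm ?_ ?_
    · simpa using ge_of_tendsto'
        ((tendsto_const_nhds (x := f x / g x)).div hlim one_ne_zero) fun n => (hbound n).2
    · simpa using le_of_tendsto' (hlim.const_mul (f x / g x)) fun n => (hbound n).1
  have hle : ∀ x y, m < x → x ≤ y → f y / g y = f x / g x := fun x y hx hxy => by
    have h1 := Nat.floor_le (sub_nonneg.2 hxy)
    have h2 := Nat.lt_floor_add_one (y - x)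
    have hn := (⌊y - x⌋₊).cast_nonneg (α := ℝ)
    rw [← hper x hx ⌊y - x⌋₊]
    exact hclose _ _ (by linarith) (by linarith) (by linarith)
  have h : f x / g x = f y / g y := by
    rcases le_total x y with h | h
    · exact (hle x y hx h).symm
    · exact hle y x hy h
  rwa [div_eq_div_iff (hg0 x hx).ne' (hg0 y hy).ne'] at h

theorem toReal_selbergLintegral_mul_beta {γ a a' b : ℝ} (hγ : 0 < 2 * γ + 1) (ha : 0 < a)
    (haγ : 0 < a + γ) (ha' : 0 < a') (haγ' : 0 < a' + γ) (hb : 0 < b) (hbγ : 0 < b + γ) :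
    (selbergLintegral γ a b).toReal *
        (ProbabilityTheory.beta a' (b + γ) * ProbabilityTheory.beta (a' + γ) (b + γ)) =
      (selbergLintegral γ a' b).toReal *
        (ProbabilityTheory.beta a (b + γ) * ProbabilityTheory.beta (a + γ) (b + γ)) := by
  have hdom : ∀ x, max 0 (-γ) < x → 0 < x ∧ 0 < x + γ := fun x hx =>
    ⟨(le_max_left _ _).trans_lt hx, by linarith [(le_max_right 0 (-γ)).trans_lt hx]⟩
  refine mul_eq_mul_of_antitoneOn_of_add_one (m := max 0 (-γ))
    (f := fun x => (selbergLintegral γ x b).toReal)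
    (g := fun x => ProbabilityTheory.beta x (b + γ) * ProbabilityTheory.beta (x + γ) (b + γ))
    (ρ := fun x => x * (x + γ) / ((x + b + γ) * (x + b + 2 * γ)))
    (fun x hx y _ hxy => ?_) (fun x hx y hy hxy => ?_) (fun x _ => ENNReal.toReal_nonneg)
    (fun x hx => ?_) (fun x hx => ?_) (fun x hx => ?_) ?_ (max_lt ha (by linarith))
    (max_lt ha' (by linarith))
  · obtain ⟨h1, h2⟩ := hdom x hx
    exact ENNReal.toReal_mono (selbergLintegral_ne_top hγ h1 h2 hb hbγ)
      (selbergLintegral_anti γ b hxy)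
  · obtain ⟨h1, h2⟩ := hdom x hx
    obtain ⟨h3, h4⟩ := hdom y hy
    exact mul_le_mul (beta_anti h1 hxy hbγ) (beta_anti h2 (by linarith) hbγ)
      (ProbabilityTheory.beta_pos h4 hbγ).le (ProbabilityTheory.beta_pos h1 hbγ).le
  · obtain ⟨h1, h2⟩ := hdom x hx
    exact mul_pos (ProbabilityTheory.beta_pos h1 hbγ) (ProbabilityTheory.beta_pos h2 hbγ)
  · obtain ⟨h1, h2⟩ := hdom x hx
    exact toReal_selbergLintegral_succ hγ h1 h2 hb hbγ
  · obtain ⟨h1, h2⟩ := hdom x hx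
    rw [add_right_comm x 1 γ, beta_add_one_left h1 hbγ, beta_add_one_left h2 hbγ,
      mul_mul_mul_comm, div_mul_div_comm]
    ring_nf
  · have h := (tendsto_add_div_add_atTop 0 (b + γ)).mul
      (tendsto_add_div_add_atTop γ (b + 2 * γ))
    rw [mul_one] at h
    refine h.congr fun x => ?_
    rw [div_mul_div_comm, add_zero, add_assoc, add_assoc]

/-- Selberg's formula for the two-dimensional Lebesgue integral. -/
theorem toReal_selbergLintegral {γ a b : ℝ} (hγ : 0 < 2 * γ + 1) (ha : 0 < a)
    (haγ : 0 < a + γ) (hb : 0 < b) (hbγ : 0 < b + γ) :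
    (selbergLintegral γ a b).toReal =
      Gamma a * Gamma b * Gamma (a + γ) * Gamma (b + γ) * Gamma (1 + 2 * γ) /
        (Gamma (a + b + γ) * Gamma (a + b + 2 * γ) * Gamma (1 + γ)) := by
  have hγ1 : 0 < 1 + γ := by linarith
  have e1 := toReal_selbergLintegral_mul_beta hγ ha haγ one_pos hγ1 hb hbγ
  have e2 := toReal_selbergLintegral_mul_beta hγ hb hbγ one_pos hγ1 one_pos hγ1
  rw [selbergLintegral_comm γ 1 b] at e1
  rw [selbergLintegral_one_one hγ] at e2
  have hab : 0 < a + (b + γ) := by linarith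
  have hab' : 0 < a + γ + (b + γ) := by linarith
  have hbb : 0 < 1 + (b + γ) := by linarith
  have hbb' : 0 < 1 + γ + (b + γ) := by linarith
  have h2 : 0 < 1 + γ * 2 := by linarith
  have g1 := Gamma_pos_of_pos ha
  have g2 := Gamma_pos_of_pos hb
  have g3 := Gamma_pos_of_pos haγ
  have g4 := Gamma_pos_of_pos hbγ
  have g5 := Gamma_pos_of_pos hab
  have g6 := Gamma_pos_of_pos hab'
  have g7 := Gamma_pos_of_pos hbb
  have g8 := Gamma_pos_of_pos hbb'
  have g9 := Gamma_pos_of_pos hγ1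
  have g10 := Gamma_pos_of_pos h2
  have r1 : Gamma (1 + (1 + γ)) = (1 + γ) * Gamma (1 + γ) := by
    rw [add_comm, Gamma_add_one hγ1.ne']
  have r2 : Gamma (1 + γ + (1 + γ)) = (1 + 2 * γ) * Gamma (1 + 2 * γ) := by
    rw [mul_comm 2 γ, ← Gamma_add_one h2.ne']; ring_nf
  simp only [ProbabilityTheory.beta, Gamma_one, r1, r2] at e1 e2
  rw [show b + (1 + γ) = 1 + (b + γ) by ring, show b + γ + (1 + γ) = 1 + γ + (b + γ) by ring] at e2
  rw [show a + b + γ = a + (b + γ) by ring, show a + b + 2 * γ = a + γ + (b + γ) by ring]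
  field_simp at e1 e2 ⊢
  linear_combination e1 + Gamma a * Gamma (a + γ) * e2

/-- The iterated Bochner integral agrees with the Lebesgue integral. -/
theorem integral_integral_selbergIntegrand {γ a b : ℝ} (h : selbergLintegral γ a b ≠ ∞) :
    ∫ x in (0 : ℝ)..1, ∫ y in (0 : ℝ)..1, selbergIntegrand γ a b x y =
      (selbergLintegral γ a b).toReal := by
  have hm := (measurable_uncurry_selbergIntegrand γ a b).ennreal_ofReal.lintegral_prod_right'
    (ν := volume.restrict (Set.Ioo (0 : ℝ) 1))
  rw [selbergLintegral, ← integral_toReal hm.aemeasurable (ae_lt_top hm h),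
    intervalIntegral.integral_of_le zero_le_one, integral_Ioc_eq_integral_Ioo]
  refine setIntegral_congr_fun measurableSet_Ioo fun x hx => ?_
  simp only
  rw [intervalIntegral.integral_of_le zero_le_one, integral_Ioc_eq_integral_Ioo,
    integral_eq_lintegral_of_nonneg_ae]
  · exact (ae_restrict_iff' measurableSet_Ioo).2 (ae_of_all _ fun y hy => selbergIntegrand_nonneg hx hy)
  · exact ((measurable_uncurry_selbergIntegrand γ a b).comp
      measurable_prodMk_left).aestronglyMeasurable

end

/-- The Selberg integral for `n = 2`. -/
theorem selberg_n_eq_two (α β γ : ℝ) (hα : 0 < α) (hβ : 0 < β)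
    (hγ : -min (1/2) (min α β) < γ) :
    (∫ t₁ in (0:ℝ)..1, ∫ t₂ in (0:ℝ)..1,
        t₁ ^ (α - 1) * t₂ ^ (α - 1) * (1 - t₁) ^ (β - 1) * (1 - t₂) ^ (β - 1) *
          |t₁ - t₂| ^ (2 * γ)) =
      ∏ j ∈ Finset.range 2,
        (Real.Gamma (α + j * γ) * Real.Gamma (β + j * γ) * Real.Gamma (1 + (j + 1) * γ)) /
          (Real.Gamma (α + β + (1 + j) * γ) * Real.Gamma (1 + γ)) := by
  rw [neg_lt, lt_min_iff, lt_min_iff] at hγ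
  obtain ⟨h1, h2, h3⟩ := hγ
  have hγ' : 0 < 2 * γ + 1 := by linarith
  have hαγ : 0 < α + γ := by linarith
  have hβγ : 0 < β + γ := by linarith
  have hne : Real.Gamma (1 + γ) ≠ 0 := (Real.Gamma_pos_of_pos (by linarith)).ne'
  refine (integral_integral_selbergIntegrand
    (selbergLintegral_ne_top hγ' hα hαγ hβ hβγ)).trans ?_
  rw [toReal_selbergLintegral hγ' hα hαγ hβ hβγ]
  simp only [Finset.prod_range_succ, Finset.prod_range_zero, Nat.cast_zero, Nat.cast_one, zero_mul,
    one_mul, add_zero, zero_add, one_add_one_eq_two]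
  rw [div_mul_div_comm, ← mul_div_mul_right _ _ hne]
  congr 1 <;> ring
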